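/- Let q ≥ 4 be an even integer, ε ∈ (0, 1/2], and write α = α_ε. Define R*₂ = 1 − h₂(2α/(1+2α)), for 0 < r ≤ 1 let δ_GV(r) be the unique δ ∈ [0, 1/2] with r = 1 − h₂(δ), and define E_ex^BSC(r) = log₂(2/(1+2α)) − r for r ≥ R*₂ and E_ex^BSC(r) = −δ_GV(r) log₂(2α) for 0 < r ≤ R*₂. Then for every rate R with log₂(q/2) < R ≤ log₂ q, the reliability function of the typewriter channel satisfies E(R) ≥ E_ex^BSC(R − log₂(q/2)). -/

import Mathlib

/-- The typewriter channel transition probabilities on `ZMod q`. -/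
noncomputable def W (q : ℕ) (ε : ℝ) (y x : ZMod q) : ℝ :=
  if y = x then 1 - ε else if y = x + 1 then ε else 0

/-- `α_ε = √(ε(1-ε))`. -/
noncomputable def alphaE (ε : ℝ) : ℝ := Real.sqrt (ε * (1 - ε))

/-- The `n`-fold memoryless extension `Wⁿ(y|x) = ∏ₖ W(yₖ|xₖ)`. -/
noncomputable def Wn (q : ℕ) [NeZero q] (n : ℕ) (ε : ℝ) (y x : Fin n → ZMod q) : ℝ :=
  ∏ k, W q ε (y k) (x k)

/-- `Pe(M,n)`: the smallest average error probability over all encoders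
`f : Fin M → (ZMod q)ⁿ` and decoders `φ : (ZMod q)ⁿ → Fin M`. -/
noncomputable def Pe (q : ℕ) [NeZero q] (ε : ℝ) (M n : ℕ) : ℝ :=
  sInf {p : ℝ | ∃ f : Fin M → (Fin n → ZMod q), ∃ φ : (Fin n → ZMod q) → Fin M,
    p = (1 / M) * ∑ m : Fin M, ∑ y : Fin n → ZMod q,
      if φ y = m then 0 else Wn q n ε y (f m)}

/-- The reliability function
`E(R) = limsup_{n→∞} (1/n) log₂ (1 / Pe(⌈2^{nR}⌉, n))`. -/
noncomputable def EReliability (q : ℕ) [NeZero q] (ε : ℝ) (R : ℝ) : ℝ :=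
  Filter.limsup (fun n : ℕ =>
    (1 / (n : ℝ)) * Real.logb 2 (1 / Pe q ε (⌈(2 : ℝ) ^ ((n : ℝ) * R)⌉₊) n))
    Filter.atTop

/-- Binary entropy function (base 2), extended by `log 0 = 0`. -/
noncomputable def h2 (x : ℝ) : ℝ := -(x * Real.logb 2 x) - (1 - x) * Real.logb 2 (1 - x)

/-- The Bhattacharyya coefficient of two inputs of the typewriter channel. -/
noncomputable def bhattacharyya (q : ℕ) [NeZero q] (ε : ℝ) (x x' : ZMod q) : ℝ :=
  ∑ y, √(W q ε y x) * √(W q ε y x')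

/-- The input with index `u` among those of parity `b`. -/
def inputOfParity (q : ℕ) (u : ℕ) (b : ZMod 2) : ZMod q := ((2 * u + b.val : ℕ) : ZMod q)

/-- The factor contributed by one coordinate to `t` raised to the Hamming weight. -/
def weightFactor (t : ℝ) (b : ZMod 2) : ℝ := if b = 0 then 1 else t

lemma weightFactor_nonneg {t : ℝ} (ht : 0 ≤ t) (b : ZMod 2) : 0 ≤ weightFactor t b := by
  unfold weightFactor; split_ifs <;> simp [ht]

lemma weightFactor_rpow (t s : ℝ) (b : ZMod 2) :
    weightFactor t b ^ s = weightFactor (t ^ s) b := by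
  unfold weightFactor; split_ifs <;> simp

lemma W_nonneg (q : ℕ) {ε : ℝ} (h0 : 0 ≤ ε) (h1 : ε ≤ 1) (y x : ZMod q) : 0 ≤ W q ε y x := by
  unfold W; split_ifs <;> linarith

lemma Wn_nonneg (q : ℕ) [NeZero q] {n : ℕ} {ε : ℝ} (h0 : 0 ≤ ε) (h1 : ε ≤ 1)
    (y x : Fin n → ZMod q) : 0 ≤ Wn q n ε y x :=
  Finset.prod_nonneg fun _ _ => W_nonneg q h0 h1 _ _

lemma bhattacharyya_nonneg (q : ℕ) [NeZero q] (ε : ℝ) (x x' : ZMod q) :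
    0 ≤ bhattacharyya q ε x x' :=
  Finset.sum_nonneg fun _ _ => by positivity

lemma bhattacharyya_le (q : ℕ) [NeZero q] {ε : ℝ} (h0 : 0 ≤ ε) (h1 : ε ≤ 1) (x x' : ZMod q) :
    bhattacharyya q ε x x' ≤ (if x' = x then 1 else 0) + (if x' = x + 1 then alphaE ε else 0)
      + (if x' = x - 1 then alphaE ε else 0) := by
  have hW : ∀ y x : ZMod q, √(W q ε y x) ≤
      (if y = x then √(1 - ε) else 0) + (if y = x + 1 then √ε else 0) := by
    intro y x
    unfold W
    split_ifs <;> simp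
  have hε : √ε * √ε = ε := Real.mul_self_sqrt h0
  have hε' : √(1 - ε) * √(1 - ε) = 1 - ε := Real.mul_self_sqrt (by linarith)
  have hα : √ε * √(1 - ε) = alphaE ε := by
    rw [alphaE, Real.sqrt_mul h0]
  have hα' : √(1 - ε) * √ε = alphaE ε := by rw [mul_comm, hα]
  have hx : x' + 1 = x ↔ x' = x - 1 := eq_sub_iff_add_eq.symm
  calc bhattacharyya q ε x x'
      ≤ ∑ y, ((if y = x then √(1 - ε) else 0) + (if y = x + 1 then √ε else 0)) *
          ((if y = x' then √(1 - ε) else 0) + (if y = x' + 1 then √ε else 0)) :=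
        Finset.sum_le_sum fun y _ => mul_le_mul (hW _ _) (hW _ _) (Real.sqrt_nonneg _)
          ((Real.sqrt_nonneg _).trans (hW _ _))
    _ = _ := by
        simp only [add_mul, ite_mul, zero_mul, Finset.sum_add_distrib, Finset.sum_ite_eq',
          Finset.mem_univ, if_true, mul_add, mul_ite, mul_zero, hε, hε', hα, hα', add_left_inj,
          hx]
        split_ifs <;> ring

lemma inputOfParity_parity {q p : ℕ} (hq : q = 2 * p) (u : ℕ) (b : ZMod 2) :
    ZMod.castHom (Dvd.intro p hq.symm) (ZMod 2) (inputOfParity q u b) = b := by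
  have h2 : (2 : ZMod 2) = 0 := rfl
  rw [inputOfParity, map_natCast]
  simp [h2]

lemma inputOfParity_injective {q p : ℕ} (hq : q = 2 * p) (b : ZMod 2) :
    Function.Injective fun u : Fin p => inputOfParity q u b := by
  intro u v h
  have hb := ZMod.val_lt b
  simp only [inputOfParity, ZMod.natCast_eq_natCast_iff'] at h
  rw [Nat.mod_eq_of_lt (by omega), Nat.mod_eq_of_lt (by omega)] at h
  exact Fin.ext (by omega)

lemma bhattacharyya_inputOfParity_self {q p : ℕ} [NeZero q] (hq : q = 2 * p) {ε : ℝ}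
    (h0 : 0 ≤ ε) (h1 : ε ≤ 1) (u u' : ℕ) (b : ZMod 2) :
    bhattacharyya q ε (inputOfParity q u b) (inputOfParity q u' b) ≤
      if inputOfParity q u' b = inputOfParity q u b then 1 else 0 := by
  have hne : ∀ a : ZMod 2, a ≠ a + 1 ∧ a ≠ a - 1 := by decide
  have hadd : inputOfParity q u' b ≠ inputOfParity q u b + 1 := by
    intro e
    have := congrArg (ZMod.castHom (Dvd.intro p hq.symm) (ZMod 2)) e
    rw [map_add, map_one, inputOfParity_parity hq, inputOfParity_parity hq] at this
    exact (hne b).1 this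
  have hsub : inputOfParity q u' b ≠ inputOfParity q u b - 1 := by
    intro e
    have := congrArg (ZMod.castHom (Dvd.intro p hq.symm) (ZMod 2)) e
    rw [map_sub, map_one, inputOfParity_parity hq, inputOfParity_parity hq] at this
    exact (hne b).2 this
  have h := bhattacharyya_le q h0 h1 (inputOfParity q u b) (inputOfParity q u' b)
  rwa [if_neg hadd, if_neg hsub, add_zero, add_zero] at h

lemma sum_ite_eq_le_of_injective {α β : Type*} [Fintype α] [DecidableEq β] {f : α → β}
    (hf : Function.Injective f) (z : β) {c : ℝ} (hc : 0 ≤ c) :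
    ∑ u, (if f u = z then c else 0) ≤ c := by
  classical
  by_cases h : ∃ u, f u = z
  · obtain ⟨u, rfl⟩ := h
    simp [hf.eq_iff]
  · push Not at h
    simp [h, hc]

lemma sum_bhattacharyya_inputOfParity_le {q p : ℕ} [NeZero q] (hq : q = 2 * p) {ε : ℝ}
    (h0 : 0 ≤ ε) (h1 : ε ≤ 1) (u : ℕ) (b b' : ZMod 2) :
    ∑ u' : Fin p, bhattacharyya q ε (inputOfParity q u b) (inputOfParity q u' b') ≤
      weightFactor (2 * alphaE ε) (b' - b) := by
  have hα : 0 ≤ alphaE ε := Real.sqrt_nonneg _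
  by_cases hb : b' = b
  · subst hb
    simp only [weightFactor, sub_self, if_true]
    exact (Finset.sum_le_sum fun (u' : Fin p) _ =>
      bhattacharyya_inputOfParity_self hq h0 h1 u u' b').trans
        (sum_ite_eq_le_of_injective (inputOfParity_injective hq b') _ zero_le_one)
  · have hne : ∀ u' : ℕ, inputOfParity q u' b' ≠ inputOfParity q u b := by
      intro u' e
      have := congrArg (ZMod.castHom (Dvd.intro p hq.symm) (ZMod 2)) e
      rw [inputOfParity_parity hq, inputOfParity_parity hq] at this
      exact hb this
    rw [weightFactor, if_neg (sub_ne_zero.mpr hb), two_mul]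
    calc ∑ u' : Fin p, bhattacharyya q ε (inputOfParity q u b) (inputOfParity q u' b')
        ≤ ∑ u' : Fin p,
            ((if inputOfParity q u' b' = inputOfParity q u b + 1 then alphaE ε else 0)
            + (if inputOfParity q u' b' = inputOfParity q u b - 1 then alphaE ε else 0)) := by
          refine Finset.sum_le_sum fun u' _ => ?_
          have h := bhattacharyya_le q h0 h1 (inputOfParity q u b) (inputOfParity q u' b')
          rwa [if_neg (hne u'), zero_add] at h
      _ ≤ _ := by
          rw [Finset.sum_add_distrib]
          exact add_le_add
            (sum_ite_eq_le_of_injective (inputOfParity_injective hq b') _ hα)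
            (sum_ite_eq_le_of_injective (inputOfParity_injective hq b') _ hα)

/-- Averaging over all generator matrices, some binary linear code has at most the average
weight enumerator. -/
lemma exists_matrix_sum_weightFactor_le (n k : ℕ) {t : ℝ} (ht : 0 ≤ t) :
    ∃ G : Matrix (Fin n) (Fin k) (ZMod 2),
      ∑ v, (if v = 0 then 0 else ∏ i, weightFactor t (G.mulVec v i)) ≤
        2 ^ k / 2 ^ n * (1 + t) ^ n := by
  classical
  let F : (Fin n → ZMod 2) → ℝ := fun c => ∏ i, weightFactor t (c i)
  have hF : ∑ c, F c = (1 + t) ^ n := by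
    rw [← Fintype.prod_sum fun (_ : Fin n) b => weightFactor t b]
    have : ∑ b, weightFactor t b = 1 + t := by
      rw [show (Finset.univ : Finset (ZMod 2)) = {0, 1} from rfl, Finset.sum_pair (by decide)]
      simp [weightFactor]
    simp [this]
  have key : ∀ v : Fin k → ZMod 2, v ≠ 0 →
      (2 : ℝ) ^ n * ∑ G : Matrix (Fin n) (Fin k) (ZMod 2), F (G.mulVec v) =
        Fintype.card (Matrix (Fin n) (Fin k) (ZMod 2)) * (1 + t) ^ n := by
    intro v hv
    obtain ⟨j, hj⟩ := Function.ne_iff.mp hv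
    have hj1 : v j = 1 := by
      have : ∀ a : ZMod 2, a ≠ 0 → a = 1 := by decide
      exact this _ hj
    have hshift : ∀ c : Fin n → ZMod 2,
        ∑ G : Matrix (Fin n) (Fin k) (ZMod 2), F (G.mulVec v) =
          ∑ G : Matrix (Fin n) (Fin k) (ZMod 2), F (G.mulVec v + c) := by
      intro c
      rw [← Equiv.sum_comp (Equiv.addRight (Matrix.vecMulVec c (Pi.single j 1)))]
      refine Finset.sum_congr rfl fun G _ => ?_
      congr 1
      simp [Matrix.add_mulVec, Matrix.vecMulVec_mulVec, hj1]
    calc (2 : ℝ) ^ n * ∑ G : Matrix (Fin n) (Fin k) (ZMod 2), F (G.mulVec v)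
        = ∑ c : Fin n → ZMod 2, ∑ G : Matrix (Fin n) (Fin k) (ZMod 2), F (G.mulVec v + c) := by
          rw [← Finset.sum_congr rfl fun c _ => hshift c]
          simp
      _ = ∑ G : Matrix (Fin n) (Fin k) (ZMod 2), ∑ c : Fin n → ZMod 2, F (G.mulVec v + c) :=
          Finset.sum_comm
      _ = _ := by
          have : ∀ G : Matrix (Fin n) (Fin k) (ZMod 2),
              ∑ c : Fin n → ZMod 2, F (G.mulVec v + c) = (1 + t) ^ n := fun G => by
            rw [← hF]
            exact Equiv.sum_comp (Equiv.addLeft (G.mulVec v)) F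
          simp [this]
  set N : ℝ := (Fintype.card (Matrix (Fin n) (Fin k) (ZMod 2)) : ℝ) with hN
  have hle : ∀ v : Fin k → ZMod 2, ∑ G : Matrix (Fin n) (Fin k) (ZMod 2),
      (if v = 0 then 0 else F (G.mulVec v)) ≤ N * (1 + t) ^ n / 2 ^ n := by
    intro v
    by_cases hv : v = 0
    · simp only [hv, if_true, Finset.sum_const_zero]
      positivity
    · simp only [hv, if_false]
      rw [le_div_iff₀' (by positivity), key v hv]
  have hsum : ∑ G : Matrix (Fin n) (Fin k) (ZMod 2), ∑ v, (if v = 0 then 0 else F (G.mulVec v)) ≤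
      ∑ _G : Matrix (Fin n) (Fin k) (ZMod 2), 2 ^ k / 2 ^ n * (1 + t) ^ n := by
    rw [Finset.sum_comm]
    refine (Finset.sum_le_sum fun v _ => hle v).trans (le_of_eq ?_)
    simp only [Finset.sum_const, Finset.card_univ, nsmul_eq_mul, ← hN]
    simp
    ring
  obtain ⟨G, -, hG⟩ := Finset.exists_le_of_sum_le Finset.univ_nonempty hsum
  exact ⟨G, hG⟩

lemma sum_sqrt_Wn_mul_sqrt_Wn (q : ℕ) [NeZero q] {n : ℕ} {ε : ℝ} (h0 : 0 ≤ ε) (h1 : ε ≤ 1)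
    (x x' : Fin n → ZMod q) :
    ∑ y, √(Wn q n ε y x) * √(Wn q n ε y x') = ∏ k, bhattacharyya q ε (x k) (x' k) := by
  classical
  unfold bhattacharyya Wn
  rw [Fintype.prod_sum]
  refine Finset.sum_congr rfl fun y _ => ?_
  rw [Real.sqrt_prod _ fun _ _ => W_nonneg q h0 h1 _ _,
    Real.sqrt_prod _ fun _ _ => W_nonneg q h0 h1 _ _, Finset.prod_mul_distrib]

/-- Maximum likelihood decoding satisfies the union–Bhattacharyya bound. -/
lemma exists_decoder (q : ℕ) [NeZero q] {n M : ℕ} (hM : 0 < M) {ε : ℝ} (h0 : 0 ≤ ε) (h1 : ε ≤ 1)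
    (f : Fin M → Fin n → ZMod q) :
    ∃ φ : (Fin n → ZMod q) → Fin M, ∀ m,
      ∑ y, (if φ y = m then 0 else Wn q n ε y (f m)) ≤
        ∑ m', if m' = m then 0 else ∏ k, bhattacharyya q ε (f m k) (f m' k) := by
  have : Nonempty (Fin M) := ⟨⟨0, hM⟩⟩
  choose φ hφ using fun y => Finite.exists_max fun m => Wn q n ε y (f m)
  refine ⟨φ, fun m => ?_⟩
  have hterm : ∀ y, (if φ y = m then 0 else Wn q n ε y (f m)) ≤
      ∑ m', if m' = m then 0 else √(Wn q n ε y (f m)) * √(Wn q n ε y (f m')) := by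
    intro y
    have hnn : ∀ m' ∈ Finset.univ,
        0 ≤ if m' = m then 0 else √(Wn q n ε y (f m)) * √(Wn q n ε y (f m')) := by
      intro m' _
      split_ifs <;> positivity
    split_ifs with h
    · exact Finset.sum_nonneg hnn
    · refine le_trans ?_ (Finset.single_le_sum hnn (Finset.mem_univ (φ y)))
      rw [if_neg h]
      calc Wn q n ε y (f m) = √(Wn q n ε y (f m)) * √(Wn q n ε y (f m)) :=
            (Real.mul_self_sqrt (Wn_nonneg q h0 h1 _ _)).symm
        _ ≤ _ := mul_le_mul_of_nonneg_left (Real.sqrt_le_sqrt (hφ y m)) (Real.sqrt_nonneg _)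
  refine (Finset.sum_le_sum fun y _ => hterm y).trans (le_of_eq ?_)
  rw [Finset.sum_comm]
  refine Finset.sum_congr rfl fun m' _ => ?_
  split_ifs
  · simp
  · exact sum_sqrt_Wn_mul_sqrt_Wn q h0 h1 _ _

lemma averageError_nonneg (q : ℕ) [NeZero q] {n M : ℕ} {ε : ℝ} (h0 : 0 ≤ ε) (h1 : ε ≤ 1)
    (f : Fin M → Fin n → ZMod q) (φ : (Fin n → ZMod q) → Fin M) :
    0 ≤ (1 / M : ℝ) * ∑ m : Fin M, ∑ y, if φ y = m then 0 else Wn q n ε y (f m) := by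
  refine mul_nonneg (by positivity) (Finset.sum_nonneg fun m _ => Finset.sum_nonneg fun y _ => ?_)
  split_ifs
  · rfl
  · exact Wn_nonneg q h0 h1 _ _

lemma Pe_le_of_code (q : ℕ) [NeZero q] {n M : ℕ} (hM : 0 < M) {ε : ℝ} (h0 : 0 ≤ ε) (h1 : ε ≤ 1)
    {ι : Type*} [Fintype ι] [DecidableEq ι] (hι : M ≤ Fintype.card ι) (x : ι → Fin n → ZMod q)
    {P : ℝ} (hP : ∀ i, ∑ j, (if j = i then 0 else ∏ k, bhattacharyya q ε (x i k) (x j k)) ≤ P) :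
    Pe q ε M n ≤ P := by
  obtain ⟨e⟩ := Function.Embedding.nonempty_of_card_le (α := Fin M) (β := ι) (by simpa using hι)
  obtain ⟨φ, hφ⟩ := exists_decoder q hM h0 h1 fun m => x (e m)
  have hm : ∀ m, ∑ y, (if φ y = m then 0 else Wn q n ε y (x (e m))) ≤ P := by
    intro m
    refine (hφ m).trans (le_trans ?_ (hP (e m)))
    have hnn : ∀ j : ι, 0 ≤ if j = e m then 0 else
        ∏ k, bhattacharyya q ε (x (e m) k) (x j k) := by
      intro j
      split_ifs
      · rfl
      · exact Finset.prod_nonneg fun _ _ => bhattacharyya_nonneg _ _ _ _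
    calc _ = ∑ m', if e m' = e m then 0 else
          ∏ k, bhattacharyya q ε (x (e m) k) (x (e m') k) := by
          simp only [e.injective.eq_iff]
      _ = ∑ j ∈ Finset.univ.map e, if j = e m then 0 else
          ∏ k, bhattacharyya q ε (x (e m) k) (x j k) := by rw [Finset.sum_map]
      _ ≤ _ := Finset.sum_le_sum_of_subset_of_nonneg (Finset.subset_univ _) fun j _ _ => hnn j
  refine csInf_le_of_le ⟨0, ?_⟩ ⟨fun m => x (e m), φ, rfl⟩ ?_
  · rintro _ ⟨f, φ, rfl⟩
    exact averageError_nonneg q h0 h1 f φ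
  · have hM' : (0 : ℝ) < M := by exact_mod_cast hM
    rw [one_div, inv_mul_le_iff₀ hM']
    refine (Finset.sum_le_sum fun m _ => hm m).trans ?_
    simp

/-- The `ℓ^s` quasi-norms decrease in `s`. -/
lemma sum_le_sum_rpow_rpow_inv {ι : Type*} (S : Finset ι) {a : ι → ℝ} (ha : ∀ i ∈ S, 0 ≤ a i)
    {s : ℝ} (hs : 0 < s) (hs1 : s ≤ 1) :
    ∑ i ∈ S, a i ≤ (∑ i ∈ S, a i ^ s) ^ s⁻¹ := by
  set A := ∑ i ∈ S, a i ^ s with hA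
  have hnn : ∀ i ∈ S, 0 ≤ a i ^ s := fun i hi => Real.rpow_nonneg (ha i hi) s
  have hA0 : 0 ≤ A := Finset.sum_nonneg hnn
  have hinv : 1 ≤ s⁻¹ := (one_le_inv₀ hs).mpr hs1
  have hsplit : ∀ {z : ℝ}, 0 ≤ z → z ^ s⁻¹ = z * z ^ (s⁻¹ - 1) := by
    intro z hz
    rcases hz.eq_or_lt with rfl | hz
    · simp [hs.ne']
    · rw [← Real.rpow_one_add' hz.le (by simp [hs.ne'])]
      congr 1
      ring
  calc ∑ i ∈ S, a i ≤ ∑ i ∈ S, a i ^ s * A ^ (s⁻¹ - 1) := by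
        refine Finset.sum_le_sum fun i hi => ?_
        calc a i = (a i ^ s) ^ s⁻¹ := (Real.rpow_rpow_inv (ha i hi) hs.ne').symm
          _ = a i ^ s * (a i ^ s) ^ (s⁻¹ - 1) := hsplit (hnn i hi)
          _ ≤ _ := mul_le_mul_of_nonneg_left (Real.rpow_le_rpow (hnn i hi)
              (Finset.single_le_sum hnn hi) (by linarith)) (hnn i hi)
    _ = A ^ s⁻¹ := by rw [← Finset.sum_mul, ← hA, hsplit hA0]

/-- The expurgated bound, for the code of all words whose parities form a word of a binary
linear code. -/
lemma Pe_le_expurgated {q p : ℕ} [NeZero q] (hq : q = 2 * p) {ε : ℝ} (h0 : 0 ≤ ε) (h1 : ε ≤ 1)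
    {n k M : ℕ} (hM : 0 < M) (hMle : M ≤ p ^ n * 2 ^ k) {s : ℝ} (hs : 0 < s) (hs1 : s ≤ 1) :
    Pe q ε M n ≤ (2 ^ k / 2 ^ n * (1 + (2 * alphaE ε) ^ s) ^ n) ^ s⁻¹ := by
  have hZ : 0 ≤ 2 * alphaE ε := mul_nonneg zero_le_two (Real.sqrt_nonneg _)
  obtain ⟨G, hG⟩ := exists_matrix_sum_weightFactor_le n k (Real.rpow_nonneg hZ s)
  have hG' : ∑ v, (if v = 0 then 0 else ∏ i, weightFactor (2 * alphaE ε) (G.mulVec v i)) ≤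
      (2 ^ k / 2 ^ n * (1 + (2 * alphaE ε) ^ s) ^ n) ^ s⁻¹ := by
    have hnn : ∀ v : Fin k → ZMod 2,
        0 ≤ if v = 0 then 0 else ∏ i, weightFactor (2 * alphaE ε) (G.mulVec v i) := by
      intro v
      split_ifs
      · rfl
      · exact Finset.prod_nonneg fun _ _ => weightFactor_nonneg hZ _
    refine (sum_le_sum_rpow_rpow_inv _ (fun v _ => hnn v) hs hs1).trans ?_
    refine Real.rpow_le_rpow (Finset.sum_nonneg fun v _ => Real.rpow_nonneg (hnn v) s)
      (le_trans (le_of_eq (Finset.sum_congr rfl fun v _ => ?_)) hG) (inv_nonneg.mpr hs.le)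
    split_ifs
    · exact Real.zero_rpow hs.ne'
    · rw [← Real.finsetProd_rpow _ _ fun _ _ => weightFactor_nonneg hZ _]
      simp only [weightFactor_rpow]
  refine Pe_le_of_code q hM h0 h1 (ι := (Fin n → Fin p) × (Fin k → ZMod 2)) (by simpa using hMle)
    (fun w i => inputOfParity q (w.1 i) (G.mulVec w.2 i)) fun w => le_trans ?_ hG'
  obtain ⟨u, v⟩ := w
  let B : (Fin n → Fin p) → (Fin k → ZMod 2) → ℝ := fun u' v' =>
    ∏ i, bhattacharyya q ε (inputOfParity q (u i) (G.mulVec v i))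
      (inputOfParity q (u' i) (G.mulVec v' i))
  have hB0 : ∀ u' v', 0 ≤ B u' v' := fun u' v' =>
    Finset.prod_nonneg fun _ _ => bhattacharyya_nonneg _ _ _ _
  have hsame : ∀ u', u' ≠ u → B u' v = 0 := by
    intro u' hu
    obtain ⟨i, hi⟩ := Function.ne_iff.mp hu
    refine Finset.prod_eq_zero (Finset.mem_univ i) (le_antisymm ?_ (bhattacharyya_nonneg _ _ _ _))
    have h := bhattacharyya_inputOfParity_self hq h0 h1 (u i) (u' i) (G.mulVec v i)
    rwa [if_neg ((inputOfParity_injective hq (G.mulVec v i)).ne hi)] at h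
  calc ∑ j : (Fin n → Fin p) × (Fin k → ZMod 2), (if j = (u, v) then 0 else B j.1 j.2)
      ≤ ∑ j : (Fin n → Fin p) × (Fin k → ZMod 2), (if j.2 = v then 0 else B j.1 j.2) := by
        refine Finset.sum_le_sum fun j _ => ?_
        obtain ⟨u', v'⟩ := j
        by_cases hv : v' = v
        · subst hv
          by_cases hu : u' = u
          · simp [hu]
          · simp [hu, hsame u' hu]
        · simp [hv]
    _ = ∑ v', if v' = v then 0 else ∑ u', B u' v' := by
        rw [Fintype.sum_prod_type_right]
        refine Finset.sum_congr rfl fun v' _ => ?_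
        split_ifs <;> simp
    _ ≤ ∑ v', if v' - v = 0 then 0 else
          ∏ i, weightFactor (2 * alphaE ε) (G.mulVec (v' - v) i) := by
        refine Finset.sum_le_sum fun v' _ => ?_
        simp only [sub_eq_zero]
        split_ifs
        · rfl
        · rw [← Fintype.prod_sum fun i (a : Fin p) =>
            bhattacharyya q ε (inputOfParity q (u i) (G.mulVec v i))
              (inputOfParity q a (G.mulVec v' i))]
          refine Finset.prod_le_prod (fun i _ => Finset.sum_nonneg fun _ _ =>
            bhattacharyya_nonneg _ _ _ _) fun i _ => ?_
          rw [Matrix.mulVec_sub, Pi.sub_apply]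
          exact sum_bhattacharyya_inputOfParity_le hq h0 h1 _ _ _
    _ = _ := Equiv.sum_comp (Equiv.subRight v) fun v' => if v' = 0 then 0 else
          ∏ i, weightFactor (2 * alphaE ε) (G.mulVec v' i)

/-- Above the zero-error rate, two codewords share an output sequence. -/
lemma le_Pe {q p : ℕ} [NeZero q] (hq : q = 2 * p) {ε : ℝ} (h0 : 0 ≤ ε) (hε : ε ≤ 1 / 2)
    {n M : ℕ} (hM : p ^ n < M) : ε ^ n / M ≤ Pe q ε M n := by
  have hM0 : 0 < M := by omega
  have h1 : ε ≤ 1 := by linarith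
  have hne : Nonempty (Fin M) := ⟨⟨0, hM0⟩⟩
  refine le_csInf ⟨_, fun _ => 0, fun _ => hne.some, rfl⟩ ?_
  rintro _ ⟨f, φ, rfl⟩
  have hlt : ∀ a : ZMod q, a.val / 2 < p := fun a => by
    have := ZMod.val_lt a
    omega
  obtain ⟨m, m', hmm, hf⟩ := Fintype.exists_ne_map_eq_of_card_lt
    (fun m i => (⟨(f m i).val / 2, hlt _⟩ : Fin p)) (by simpa using hM)
  have hval : ∀ i, (f m i).val / 2 = (f m' i).val / 2 := fun i =>
    congrArg Fin.val (congrFun hf i)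
  have hWle : ∀ x : ZMod q, ε ≤ W q ε ((2 * (x.val / 2) + 1 : ℕ) : ZMod q) x := by
    intro x
    have hx : ((2 * (x.val / 2) + 1 : ℕ) : ZMod q) = x ∨
        ((2 * (x.val / 2) + 1 : ℕ) : ZMod q) = x + 1 := by
      rcases Nat.mod_two_eq_zero_or_one x.val with h | h
      · right
        rw [show 2 * (x.val / 2) + 1 = x.val + 1 by omega]
        simp
      · left
        rw [show 2 * (x.val / 2) + 1 = x.val by omega]
        simp
    unfold W
    split_ifs with ha hb
    · linarith
    · rfl
    · tauto
  let y : Fin n → ZMod q := fun i => ((2 * ((f m i).val / 2) + 1 : ℕ) : ZMod q)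
  have hpow : ∀ x : Fin n → ZMod q, (∀ i, y i = ((2 * ((x i).val / 2) + 1 : ℕ) : ZMod q)) →
      ε ^ n ≤ Wn q n ε y x := by
    intro x hx
    calc ε ^ n = ∏ _i : Fin n, ε := by simp
      _ ≤ _ := Finset.prod_le_prod (fun _ _ => h0) fun i _ => by rw [hx i]; exact hWle _
  have hym : ε ^ n ≤ Wn q n ε y (f m) := hpow _ fun i => rfl
  have hym' : ε ^ n ≤ Wn q n ε y (f m') := hpow _ fun i => by simp only [y, hval i]
  have hnn : ∀ (m : Fin M) (z : Fin n → ZMod q),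
      0 ≤ if φ z = m then 0 else Wn q n ε z (f m) := by
    intro m z
    split_ifs
    · rfl
    · exact Wn_nonneg q h0 h1 _ _
  have herr : ∀ m₀, φ y ≠ m₀ → ε ^ n ≤ Wn q n ε y (f m₀) →
      ε ^ n ≤ ∑ m : Fin M, ∑ z, if φ z = m then 0 else Wn q n ε z (f m) := by
    intro m₀ hm₀ hle
    calc ε ^ n ≤ if φ y = m₀ then 0 else Wn q n ε y (f m₀) := by rwa [if_neg hm₀]
      _ ≤ ∑ z, if φ z = m₀ then 0 else Wn q n ε z (f m₀) :=
          Finset.single_le_sum (f := fun z => if φ z = m₀ then 0 else Wn q n ε z (f m₀))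
            (fun z _ => hnn m₀ z) (Finset.mem_univ y)
      _ ≤ _ := Finset.single_le_sum
            (f := fun m => ∑ z, if φ z = m then 0 else Wn q n ε z (f m))
            (fun m _ => Finset.sum_nonneg fun z _ => hnn m z) (Finset.mem_univ m₀)
  rw [one_div, inv_mul_eq_div]
  refine div_le_div_of_nonneg_right ?_ (Nat.cast_nonneg M)
  by_cases h : φ y = m
  · exact herr m' (h ▸ hmm) hym'
  · exact herr m h hym

/-- The expurgated exponent with parameter `s = 1 / ρ` is achievable. -/
lemma expurgated_exponent_le_EReliability (q : ℕ) [NeZero q] (hqe : Even q)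
    {ε : ℝ} (hε : 0 < ε) (hε' : ε ≤ 1 / 2) {R : ℝ}
    (hR1 : Real.logb 2 ((q : ℝ) / 2) < R) (hR2 : R ≤ Real.logb 2 (q : ℝ))
    {s : ℝ} (hs : 0 < s) (hs1 : s ≤ 1) :
    s⁻¹ * (1 - (R - Real.logb 2 ((q : ℝ) / 2)) - Real.logb 2 (1 + (2 * alphaE ε) ^ s)) ≤
      EReliability q ε R := by
  obtain ⟨p, hp⟩ := hqe.exists_two_nsmul
  rw [smul_eq_mul] at hp
  have hq0 : (0 : ℝ) < q := by exact_mod_cast NeZero.pos q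
  have hqp : (q : ℝ) = 2 * p := by exact_mod_cast hp
  have hp0 : (0 : ℝ) < p := by linarith
  have hqp' : (q : ℝ) / 2 = p := by linarith
  rw [hqp'] at hR1 ⊢
  set r := R - Real.logb 2 (p : ℝ) with hr
  set t := (2 * alphaE ε) ^ s with ht
  have ht0 : 0 ≤ t := Real.rpow_nonneg (mul_nonneg zero_le_two (Real.sqrt_nonneg _)) s
  set L := Real.logb 2 (1 + t) with hL
  have hr0 : 0 < r := by linarith
  have hr1 : r ≤ 1 := by
    rw [hqp, Real.logb_mul two_ne_zero hp0.ne', Real.logb_self_eq_one one_lt_two] at hR2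
    linarith
  have hpow : ∀ n : ℕ, (2 : ℝ) ^ ((n : ℝ) * R) = (p : ℝ) ^ n * 2 ^ ((n : ℝ) * r) := by
    intro n
    rw [show (n : ℝ) * R = Real.logb 2 p * n + n * r by rw [hr]; ring,
      Real.rpow_add two_pos, Real.rpow_mul two_pos.le, Real.rpow_logb two_pos (by norm_num) hp0,
      Real.rpow_natCast]
  have hbound : ∀ n : ℕ, 1 ≤ n →
      s⁻¹ * (1 - r - L) - s⁻¹ * (1 / (n : ℝ)) ≤
        (1 / (n : ℝ)) * Real.logb 2 (1 / Pe q ε (⌈(2 : ℝ) ^ ((n : ℝ) * R)⌉₊) n) ∧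
      (1 / (n : ℝ)) * Real.logb 2 (1 / Pe q ε (⌈(2 : ℝ) ^ ((n : ℝ) * R)⌉₊) n) ≤
        -Real.logb 2 (ε / q) := by
    intro n hn
    have hn0 : (0 : ℝ) < n := by exact_mod_cast hn
    set M := ⌈(2 : ℝ) ^ ((n : ℝ) * R)⌉₊ with hM
    have hpn : (0 : ℝ) < (p : ℝ) ^ n := by positivity
    have hMgt : p ^ n < M := by
      rw [hM, Nat.lt_ceil, hpow]
      push_cast
      exact lt_mul_of_one_lt_right hpn (Real.one_lt_rpow one_lt_two (by positivity))
    have hMk : M ≤ p ^ n * 2 ^ ⌈(n : ℝ) * r⌉₊ := by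
      rw [hM, Nat.ceil_le, hpow]
      push_cast
      refine mul_le_mul_of_nonneg_left ?_ hpn.le
      rw [← Real.rpow_natCast]
      exact Real.rpow_le_rpow_of_exponent_le one_le_two (Nat.le_ceil _)
    have hMq : M ≤ q ^ n := by
      rw [hM, Nat.ceil_le, hpow]
      push_cast
      rw [hqp, mul_pow, mul_comm]
      refine mul_le_mul_of_nonneg_right ?_ hpn.le
      rw [← Real.rpow_natCast]
      exact Real.rpow_le_rpow_of_exponent_le one_le_two (mul_le_of_le_one_right hn0.le hr1)
    have hM0 : 0 < M := by omega
    have hM0' : (0 : ℝ) < M := by exact_mod_cast hM0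
    have hlow : (ε / q) ^ n ≤ Pe q ε M n := by
      refine le_trans ?_ (le_Pe hp hε.le hε' hMgt)
      rw [div_pow]
      exact div_le_div_of_nonneg_left (by positivity) hM0' (by exact_mod_cast hMq)
    have hPe : 0 < Pe q ε M n := lt_of_lt_of_le (by positivity) hlow
    have hup := Pe_le_expurgated hp hε.le (by linarith) hM0 hMk hs hs1
    rw [← ht] at hup
    have hlogup := Real.logb_le_logb_of_le one_lt_two hPe hup
    rw [Real.logb_rpow_eq_mul_logb_of_pos (by positivity),
      Real.logb_mul (by positivity) (by positivity), Real.logb_div (by positivity) (by positivity),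
      Real.logb_pow, Real.logb_pow, Real.logb_pow, Real.logb_self_eq_one one_lt_two, ← hL]
      at hlogup
    have hloglow := Real.logb_le_logb_of_le one_lt_two (by positivity) hlow
    rw [Real.logb_pow] at hloglow
    have hk : (⌈(n : ℝ) * r⌉₊ : ℝ) < n * r + 1 := Nat.ceil_lt_add_one (by positivity)
    rw [one_div (Pe q ε M n), Real.logb_inv, one_div_mul_eq_div]
    constructor
    · rw [le_div_iff₀ hn0]
      have hmul := mul_le_mul_of_nonneg_left hk.le (inv_pos.mpr hs).le
      have hcancel : s⁻¹ * (1 / (n : ℝ)) * n = s⁻¹ := by field_simp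
      rw [sub_mul, hcancel]
      linarith
    · rw [div_le_iff₀ hn0]
      linarith
  have hlim : Filter.Tendsto (fun n : ℕ => s⁻¹ * (1 - r - L) - s⁻¹ * (1 / (n : ℝ)))
      Filter.atTop (nhds (s⁻¹ * (1 - r - L))) := by
    simpa using (tendsto_one_div_atTop_nhds_zero_nat (𝕜 := ℝ)).const_mul s⁻¹ |>.const_sub
      (s⁻¹ * (1 - r - L))
  rw [← hlim.limsup_eq]
  refine Filter.limsup_le_limsup ?_ hlim.isCoboundedUnder_le ?_
  · filter_upwards [Filter.eventually_ge_atTop 1] with n hn using (hbound n hn).1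
  · refine Filter.isBoundedUnder_of_eventually_le (a := -Real.logb 2 (ε / q)) ?_
    filter_upwards [Filter.eventually_ge_atTop 1] with n hn using (hbound n hn).2

lemma h2_eq_binEntropy_div (x : ℝ) : h2 x = Real.binEntropy x / Real.log 2 := by
  simp only [h2, Real.binEntropy, Real.logb, Real.log_inv]
  ring

/-- At the Gilbert–Varshamov point the optimal parameter gives the curved exponent. -/
lemma h2_sub_logb_one_add_div {δ : ℝ} (h0 : 0 < δ) (h1 : δ < 1) :
    h2 δ - Real.logb 2 (1 + δ / (1 - δ)) = -(δ * Real.logb 2 (δ / (1 - δ))) := by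
  have h1' : 0 < 1 - δ := by linarith
  rw [show 1 + δ / (1 - δ) = (1 - δ)⁻¹ by field_simp; ring, Real.logb_inv,
    Real.logb_div h0.ne' h1'.ne', h2]
  ring

/- Statement 4: for even `q ≥ 4`, `E(R) ≥ E_ex^BSC(R - log₂(q/2))` for
`log₂(q/2) < R ≤ log₂ q`.  Here `δ` is the (unique) Gilbert–Varshamov parameter
`δ_GV(R - log₂(q/2)) ∈ [0, 1/2]`, and the two conjuncts give the two pieces of
`E_ex^BSC` (straight line above `R*₂ = 1 - h₂(2α/(1+2α))`, curved part below). -/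
theorem stmt4 (q : ℕ) [NeZero q] (hq : 4 ≤ q) (hqe : Even q)
    (ε : ℝ) (hε : 0 < ε) (hε' : ε ≤ 1 / 2)
    (R δ : ℝ) (hR1 : Real.logb 2 ((q : ℝ) / 2) < R) (hR2 : R ≤ Real.logb 2 (q : ℝ))
    (hδ0 : 0 ≤ δ) (hδ1 : δ ≤ 1 / 2)
    (hδeq : R - Real.logb 2 ((q : ℝ) / 2) = 1 - h2 δ) :
    (1 - h2 (2 * alphaE ε / (1 + 2 * alphaE ε)) ≤ R - Real.logb 2 ((q : ℝ) / 2) →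
      Real.logb 2 (2 / (1 + 2 * alphaE ε)) - (R - Real.logb 2 ((q : ℝ) / 2))
        ≤ EReliability q ε R) ∧
    (R - Real.logb 2 ((q : ℝ) / 2) ≤ 1 - h2 (2 * alphaE ε / (1 + 2 * alphaE ε)) →
      -(δ * Real.logb 2 (2 * alphaE ε)) ≤ EReliability q ε R) := by
  have hα : 0 < alphaE ε := Real.sqrt_pos.mpr (mul_pos hε (by linarith))
  have hα' : alphaE ε ≤ 1 / 2 := by
    rw [alphaE, Real.sqrt_le_left (by norm_num)]
    nlinarith [sq_nonneg (ε - 1 / 2)]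
  have hmain := fun {s : ℝ} => expurgated_exponent_le_EReliability q hqe hε hε' hR1 hR2 (s := s)
  set Z := 2 * alphaE ε with hZ
  have hZ0 : 0 < Z := by positivity
  have hZ1 : Z ≤ 1 := by linarith
  set r := R - Real.logb 2 ((q : ℝ) / 2) with hr
  have hr0 : 0 < r := by linarith
  refine ⟨fun _ => ?_, fun hle => ?_⟩
  · have h := hmain one_pos le_rfl
    rw [Real.rpow_one, inv_one, one_mul] at h
    rw [Real.logb_div two_ne_zero (by positivity), Real.logb_self_eq_one one_lt_two]
    linarith
  · have hlog2 : 0 < Real.log 2 := Real.log_pos one_lt_two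
    have hhalf : h2 (1 / 2) = 1 := by
      rw [h2_eq_binEntropy_div, one_div, Real.binEntropy_two_inv, div_self hlog2.ne']
    have hδlt : δ < 1 / 2 := lt_of_le_of_ne hδ1 fun h => by
      rw [h, hhalf] at hδeq
      linarith
    have hZlt : Z < 1 := lt_of_le_of_ne hZ1 fun h => by
      rw [h, show (1 : ℝ) / (1 + 1) = 1 / 2 by norm_num, hhalf] at hle
      linarith
    have hZδ : Z / (1 + Z) ≤ δ := by
      have hmem : Z / (1 + Z) ∈ Set.Icc (0 : ℝ) 2⁻¹ := by
        refine ⟨by positivity, ?_⟩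
        rw [div_le_iff₀ (by positivity)]
        linarith
      refine (Real.binEntropy_strictMonoOn.le_iff_le hmem ⟨hδ0, by linarith⟩).mp ?_
      rw [hδeq, h2_eq_binEntropy_div, h2_eq_binEntropy_div] at hle
      exact (div_le_div_iff_of_pos_right hlog2).mp (by linarith)
    have hδpos : 0 < δ := lt_of_lt_of_le (by positivity) hZδ
    have hδ' : 0 < 1 - δ := by linarith
    set w := δ / (1 - δ) with hw
    have hw0 : 0 < w := by positivity
    have hw1 : w < 1 := by
      rw [hw, div_lt_one hδ']
      linarith
    have hZw : Z ≤ w := by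
      rw [div_le_iff₀ (by positivity)] at hZδ
      rw [hw, le_div_iff₀ hδ']
      linarith
    have hlZ : Real.logb 2 Z < 0 := Real.logb_neg one_lt_two hZ0 hZlt
    have hlw : Real.logb 2 w < 0 := Real.logb_neg one_lt_two hw0 hw1
    have hs : 0 < Real.logb 2 w / Real.logb 2 Z := div_pos_of_neg_of_neg hlw hlZ
    have hs1 : Real.logb 2 w / Real.logb 2 Z ≤ 1 := by
      rw [div_le_one_of_neg hlZ]
      exact Real.logb_le_logb_of_le one_lt_two hZ0 hZw
    have hpow : Z ^ (Real.logb 2 w / Real.logb 2 Z) = w := by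
      refine Real.logb_injOn_pos one_lt_two (Real.rpow_pos_of_pos hZ0 _) hw0 ?_
      rw [Real.logb_rpow_eq_mul_logb_of_pos hZ0, div_mul_cancel₀ _ hlZ.ne]
    have h := hmain hs hs1
    rw [hpow, hδeq, sub_sub_cancel, hw, h2_sub_logb_one_add_div hδpos (by linarith), ← hw,
      inv_div] at h
    have hfin : Real.logb 2 Z / Real.logb 2 w * -(δ * Real.logb 2 w) = -(δ * Real.logb 2 Z) := by
      field_simp [hlw.ne]
    rwa [hfin] at h
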